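/- Let D be a PvMD with finite t-character and let I be a nonzero proper t-ideal of D. Then the following are equivalent: (a) I is t-idempotent and divisorial; (b) I = (P₁⋯Pₙ)^t for some t-idempotent prime t-ideals P₁, …, Pₙ none of which is t-maximal; (c) I = (P₁⋯Pₙ)^t for some divisorial t-idempotent prime t-ideals P₁, …, Pₙ. -/

import Mathlib

/-! Statement 18: Let D be a PvMD with finite t-character and I a nonzero proper t-ideal. TFAE: (a) I is t-idempotent and divisorial; (b) I = (P1⋯Pn)^t with the Pi t-idempotent prime t-ideals, none t-maximal; (c) I = (P1⋯Pn)^t with the Pi divisorial t-idempotent prime t-ideals. -/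

noncomputable section

/-- The image of an ideal of `D` in the fraction field of `D`, as a `D`-submodule. -/
def coeI (D : Type*) [CommRing D] [IsDomain D] (I : Ideal D) :
    Submodule D (FractionRing D) :=
  Submodule.map (Algebra.linearMap D (FractionRing D)) I

/-- The `v`-operation on `D`-submodules of the fraction field `K`:
`E^v = (E⁻¹)⁻¹`, where `E⁻¹ = (D : E) = {x ∈ K : xE ⊆ D}`. -/
def vSub (D : Type*) [CommRing D] [IsDomain D] (E : Submodule D (FractionRing D)) :
    Submodule D (FractionRing D) :=
  1 / (1 / E)

/-- The `t`-operation: `E^t = ⋃ {F^v : F` a nonzero finitely generated submodule `⊆ E}`,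
as a subset of the fraction field. -/
def tSet (D : Type*) [CommRing D] [IsDomain D] (E : Submodule D (FractionRing D)) :
    Set (FractionRing D) :=
  ⋃ F ∈ {F : Submodule D (FractionRing D) | F.FG ∧ F ≠ ⊥ ∧ F ≤ E},
    (vSub D F : Set (FractionRing D))

/-- An integral ideal `I` of `D` is a `t`-ideal if `I^t = I`. -/
def IsTIdeal (D : Type*) [CommRing D] [IsDomain D] (I : Ideal D) : Prop :=
  tSet D (coeI D I) = (coeI D I : Set (FractionRing D))

/-- A nonzero ideal `I` of `D` is `t`-idempotent if `(I²)^t = I^t`. -/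
def TIdem (D : Type*) [CommRing D] [IsDomain D] (I : Ideal D) : Prop :=
  tSet D (coeI D (I * I)) = tSet D (coeI D I)

/-- `D` is a Prüfer `v`-multiplication domain: `(F·F⁻¹)^t = D` for every nonzero
finitely generated ideal `F` of `D`. -/
def IsPvMD (D : Type*) [CommRing D] [IsDomain D] : Prop :=
  ∀ F : Ideal D, F ≠ ⊥ → F.FG →
    tSet D (coeI D F * (1 / coeI D F)) =
      ((1 : Submodule D (FractionRing D)) : Set (FractionRing D))

/-- A `t`-maximal ideal: an ideal maximal among proper integral `t`-ideals. -/
def IsTMax (D : Type*) [CommRing D] [IsDomain D] (M : Ideal D) : Prop :=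
  M ≠ ⊤ ∧ IsTIdeal D M ∧ ∀ J : Ideal D, J ≠ ⊤ → IsTIdeal D J → M ≤ J → J = M

/-- The localization `D_P` of `D` at a prime `P`, viewed as a subset of the fraction field:
the set of fractions `a / s` with `s ∉ P`. -/
def locSet (D : Type*) [CommRing D] [IsDomain D] (P : Ideal D) : Set (FractionRing D) :=
  {x | ∃ a s : D, s ∉ P ∧ x * algebraMap D (FractionRing D) s = algebraMap D (FractionRing D) a}

/-- A prime `t`-ideal `P` is `t`-sharp if `⋂ {D_M : M t-maximal, M ⊉ P} ⊄ D_P`. -/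
def IsTSharp (D : Type*) [CommRing D] [IsDomain D] (P : Ideal D) : Prop :=
  ¬ (⋂ M ∈ {M : Ideal D | IsTMax D M ∧ ¬ P ≤ M}, locSet D M) ⊆ locSet D P

/-- A prime ideal `P` of `D` is branched if there is a `P`-primary ideal distinct from `P`. -/
def IsBranched (D : Type*) [CommRing D] [IsDomain D] (P : Ideal D) : Prop :=
  ∃ Q : Ideal D, Q.IsPrimary ∧ Q.radical = P ∧ Q ≠ P

/-- `D` has finite `t`-character: every nonzero element lies in only finitely many
`t`-maximal ideals. -/
def FiniteTCharacter (D : Type*) [CommRing D] [IsDomain D] : Prop :=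
  ∀ a : D, a ≠ 0 → {M : Ideal D | IsTMax D M ∧ a ∈ M}.Finite

/-- A nonzero ideal `I` of `D` is divisorial if `(I⁻¹)⁻¹ = I`. -/
def IsDivisorial (D : Type*) [CommRing D] [IsDomain D] (I : Ideal D) : Prop :=
  vSub D (coeI D I) = coeI D I


/-! ### The `v`- and `t`-operations on integral ideals -/

/-- The divisorial closure of an integral ideal, described by divisibility in `D`. -/
def vIdeal (D : Type*) [CommRing D] [IsDomain D] (F : Ideal D) : Ideal D where
  carrier := {d | ∀ a b : D, b ≠ 0 → (∀ f ∈ F, b ∣ a * f) → b ∣ a * d}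
  add_mem' := by
    intro x y hx hy a b hb h
    rw [mul_add]
    exact dvd_add (hx a b hb h) (hy a b hb h)
  zero_mem' := by
    intro a b _ _
    simp
  smul_mem' := by
    intro c x hx a b hb h
    rw [smul_eq_mul, mul_left_comm]
    exact (hx a b hb h).mul_left c

/-- Membership in the `t`-closure of an integral ideal. -/
def TMem (D : Type*) [CommRing D] [IsDomain D] (I : Ideal D) (d : D) : Prop :=
  ∃ F : Ideal D, F.FG ∧ F ≠ ⊥ ∧ F ≤ I ∧ d ∈ vIdeal D F

section Closure

variable {D : Type*} [CommRing D] [IsDomain D]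

lemma le_vIdeal (F : Ideal D) : F ≤ vIdeal D F :=
  fun d hd _ _ _ h => h d hd

lemma vIdeal_mono {F G : Ideal D} (h : F ≤ G) : vIdeal D F ≤ vIdeal D G :=
  fun _ hd a b hb hG => hd a b hb fun f hf => hG f (h hf)

lemma vIdeal_le_of_le {F G : Ideal D} (h : F ≤ vIdeal D G) : vIdeal D F ≤ vIdeal D G :=
  fun _ hd a b hb hG => hd a b hb fun _ hf => h hf a b hb hG

lemma mem_coeI {I : Ideal D} {x : FractionRing D} :
    x ∈ coeI D I ↔ ∃ d ∈ I, algebraMap D (FractionRing D) d = x := by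
  simp [coeI]

lemma algebraMap_mem_coeI {I : Ideal D} {d : D} :
    algebraMap D (FractionRing D) d ∈ coeI D I ↔ d ∈ I := by
  rw [mem_coeI]
  constructor
  · rintro ⟨e, he, h⟩
    rwa [← IsFractionRing.injective D (FractionRing D) h]
  · exact fun h => ⟨d, h, rfl⟩

lemma coeI_le_coeI {I J : Ideal D} (h : I ≤ J) : coeI D I ≤ coeI D J :=
  Submodule.map_mono h

lemma vSub_coeI (F : Ideal D) : vSub D (coeI D F) = coeI D (vIdeal D F) := by
  have inj := IsFractionRing.injective D (FractionRing D)
  have key : ∀ (a b : D), b ≠ 0 → ∀ f : D,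
      ((algebraMap D (FractionRing D) a / algebraMap D (FractionRing D) b) *
        algebraMap D (FractionRing D) f ∈ (1 : Submodule D (FractionRing D)) ↔ b ∣ a * f) := by
    intro a b hb f
    have hb' : algebraMap D (FractionRing D) b ≠ 0 := by
      simpa using hb
    rw [Submodule.mem_one]
    constructor
    · rintro ⟨c, hc⟩
      refine ⟨c, inj ?_⟩
      rw [map_mul, map_mul, hc]
      field_simp
    · rintro ⟨c, hc⟩
      refine ⟨c, ?_⟩
      have := congrArg (algebraMap D (FractionRing D)) hc
      rw [map_mul, map_mul] at this
      field_simp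
      rw [this, mul_comm]
  ext x
  rw [vSub, Submodule.mem_div_iff_forall_mul_mem, mem_coeI]
  constructor
  · intro h
    have h1 : (1 : FractionRing D) ∈ 1 / coeI D F := by
      rw [Submodule.mem_div_iff_forall_mul_mem]
      intro y hy
      obtain ⟨d, -, rfl⟩ := mem_coeI.1 hy
      rw [one_mul, Submodule.mem_one]
      exact ⟨d, rfl⟩
    obtain ⟨d, hd⟩ := Submodule.mem_one.1 (h 1 h1)
    rw [mul_one] at hd
    subst hd
    refine ⟨d, fun a b hb hF => (key a b hb d).1 ?_, rfl⟩
    rw [mul_comm]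
    apply h
    rw [Submodule.mem_div_iff_forall_mul_mem]
    intro y hy
    obtain ⟨f, hf, rfl⟩ := mem_coeI.1 hy
    exact (key a b hb f).2 (hF f hf)
  · rintro ⟨d, hd, rfl⟩ y hy
    obtain ⟨a, b, hb, rfl⟩ := IsFractionRing.div_surjective (A := D) y
    have hb := nonZeroDivisors.ne_zero hb
    rw [mul_comm]
    refine (key a b hb d).2 (hd a b hb fun f hf => (key a b hb f).1 ?_)
    exact Submodule.mem_div_iff_forall_mul_mem.1 hy _ (algebraMap_mem_coeI.2 hf)

lemma isDivisorial_iff {I : Ideal D} : IsDivisorial D I ↔ vIdeal D I ≤ I := by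
  rw [IsDivisorial, vSub_coeI]
  constructor
  · intro h d hd
    rw [← algebraMap_mem_coeI, ← h, algebraMap_mem_coeI]
    exact hd
  · intro h
    rw [le_antisymm h (le_vIdeal I)]

lemma mem_tSet_coeI {I : Ideal D} {x : FractionRing D} :
    x ∈ tSet D (coeI D I) ↔ ∃ d, TMem D I d ∧ algebraMap D (FractionRing D) d = x := by
  have inj := IsFractionRing.injective D (FractionRing D)
  simp only [tSet, Set.mem_iUnion, Set.mem_ofPred_eq, SetLike.mem_coe, exists_prop]
  constructor
  · rintro ⟨F, ⟨hFG, hF0, hFI⟩, hx⟩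
    obtain ⟨G, rfl⟩ : ∃ G : Ideal D, coeI D G = F := by
      refine ⟨Submodule.comap (Algebra.linearMap D (FractionRing D)) F, ?_⟩
      exact Submodule.map_comap_eq_of_le (hFI.trans LinearMap.map_le_range)
    rw [vSub_coeI] at hx
    obtain ⟨d, hd, rfl⟩ := mem_coeI.1 hx
    refine ⟨d, ⟨G, Submodule.fg_of_fg_map_injective _ inj hFG, ?_, ?_, hd⟩, rfl⟩
    · rintro rfl
      exact hF0 (Submodule.map_bot _)
    · intro g hg
      exact algebraMap_mem_coeI.1 (hFI (algebraMap_mem_coeI.2 hg))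
  · rintro ⟨d, ⟨G, hFG, hG0, hGI, hd⟩, rfl⟩
    refine ⟨coeI D G, ⟨Submodule.FG.map _ hFG, ?_, coeI_le_coeI hGI⟩, ?_⟩
    · intro h
      apply hG0
      rw [eq_bot_iff]
      intro g hg
      have := algebraMap_mem_coeI.2 hg
      rw [h] at this
      simpa using this
    · rw [vSub_coeI, algebraMap_mem_coeI]
      exact hd

lemma algebraMap_mem_tSet {I : Ideal D} {d : D} :
    algebraMap D (FractionRing D) d ∈ tSet D (coeI D I) ↔ TMem D I d := by
  rw [mem_tSet_coeI]
  constructor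
  · rintro ⟨e, he, h⟩
    rwa [← IsFractionRing.injective D (FractionRing D) h]
  · exact fun h => ⟨d, h, rfl⟩

lemma tSet_eq_coeI_iff {I J : Ideal D} :
    tSet D (coeI D I) = (coeI D J : Set (FractionRing D)) ↔ ∀ d, TMem D I d ↔ d ∈ J := by
  constructor
  · intro h d
    rw [← algebraMap_mem_tSet, h, SetLike.mem_coe, algebraMap_mem_coeI]
  · intro h
    ext x
    rw [mem_tSet_coeI, SetLike.mem_coe, mem_coeI]
    simp only [h]

lemma tIdem_iff {I : Ideal D} : TIdem D I ↔ ∀ d, TMem D (I * I) d ↔ TMem D I d := by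
  constructor
  · intro h d
    rw [← algebraMap_mem_tSet, ← algebraMap_mem_tSet, h]
  · intro h
    rw [TIdem]
    ext x
    simp only [mem_tSet_coeI, h]

lemma TMem.mono {I J : Ideal D} (h : I ≤ J) {d : D} : TMem D I d → TMem D J d :=
  fun ⟨F, h1, h2, h3, h4⟩ => ⟨F, h1, h2, h3.trans h, h4⟩

lemma TMem.ne_bot {I : Ideal D} {d : D} : TMem D I d → I ≠ ⊥ := by
  rintro ⟨F, -, h2, h3, -⟩ rfl
  exact h2 (le_bot_iff.1 h3)

lemma tMem_of_mem {I : Ideal D} (hI : I ≠ ⊥) {d : D} (hd : d ∈ I) : TMem D I d := by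
  obtain ⟨a, ha, ha0⟩ := Submodule.exists_mem_ne_zero_of_ne_bot hI
  refine ⟨Ideal.span {a, d}, Submodule.fg_span (by simp), ?_, ?_, ?_⟩
  · intro h
    apply ha0
    have : a ∈ Ideal.span {a, d} := Ideal.subset_span (by simp)
    rwa [h] at this
  · rw [Ideal.span_le]
    rintro x (rfl | rfl) <;> assumption
  · exact le_vIdeal _ (Ideal.subset_span (by simp))

lemma TMem.add {I : Ideal D} {x y : D} : TMem D I x → TMem D I y → TMem D I (x + y) := by
  rintro ⟨F, h1, h2, h3, h4⟩ ⟨G, g1, g2, g3, g4⟩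
  exact ⟨F ⊔ G, Submodule.FG.sup h1 g1, fun h => h2 (sup_eq_bot_iff.1 h).1, sup_le h3 g3,
    add_mem (vIdeal_mono le_sup_left h4) (vIdeal_mono le_sup_right g4)⟩

/-- The `t`-closure of a nonzero integral ideal. -/
def tIdeal (I : Ideal D) (hI : I ≠ ⊥) : Ideal D where
  carrier := {d | TMem D I d}
  add_mem' := TMem.add
  zero_mem' := tMem_of_mem hI (zero_mem I)
  smul_mem' := fun c _ ⟨F, h1, h2, h3, h4⟩ => ⟨F, h1, h2, h3, Ideal.mul_mem_left _ c h4⟩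

lemma le_tIdeal (I : Ideal D) (hI : I ≠ ⊥) : I ≤ tIdeal I hI :=
  fun _ => tMem_of_mem hI

lemma exists_fg_le_vIdeal {I : Ideal D} (hI : I ≠ ⊥) {G : Ideal D} (hG : G.FG)
    (hGI : G ≤ tIdeal I hI) :
    ∃ F : Ideal D, F.FG ∧ F ≠ ⊥ ∧ F ≤ I ∧ G ≤ vIdeal D F := by
  induction G, hG using Submodule.fg_induction with
  | singleton x =>
    obtain ⟨F, h1, h2, h3, h4⟩ := hGI (Submodule.mem_span_singleton_self x)
    exact ⟨F, h1, h2, h3, (Submodule.span_singleton_le_iff_mem _ _).2 h4⟩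
  | sup A B _ _ hA hB =>
    obtain ⟨F, h1, h2, h3, h4⟩ := hA (le_sup_left.trans hGI)
    obtain ⟨G, g1, g2, g3, g4⟩ := hB (le_sup_right.trans hGI)
    exact ⟨F ⊔ G, Submodule.FG.sup h1 g1, fun h => h2 (sup_eq_bot_iff.1 h).1, sup_le h3 g3,
      sup_le (h4.trans (vIdeal_mono le_sup_left)) (g4.trans (vIdeal_mono le_sup_right))⟩

lemma IsTIdeal.mem_iff {I : Ideal D} (h : IsTIdeal D I) {d : D} : TMem D I d ↔ d ∈ I :=
  tSet_eq_coeI_iff.1 h d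

lemma IsTIdeal.ne_bot {I : Ideal D} (h : IsTIdeal D I) : I ≠ ⊥ :=
  (h.mem_iff.2 (zero_mem I)).ne_bot

lemma isTIdeal_of_le {I : Ideal D} (hI : I ≠ ⊥) (h : ∀ d, TMem D I d → d ∈ I) :
    IsTIdeal D I :=
  tSet_eq_coeI_iff.2 fun d => ⟨h d, tMem_of_mem hI⟩

lemma isTIdeal_tIdeal (I : Ideal D) (hI : I ≠ ⊥) : IsTIdeal D (tIdeal I hI) := by
  refine isTIdeal_of_le (ne_bot_of_le_ne_bot hI (le_tIdeal I hI)) ?_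
  rintro d ⟨G, hG, -, hGI, hd⟩
  obtain ⟨F, h1, h2, h3, h4⟩ := exists_fg_le_vIdeal hI hG hGI
  exact ⟨F, h1, h2, h3, vIdeal_le_of_le h4 hd⟩

lemma IsTIdeal.exists_le_isTMax {I : Ideal D} (hI : IsTIdeal D I) (htop : I ≠ ⊤) :
    ∃ M, IsTMax D M ∧ I ≤ M := by
  obtain ⟨M, hIM, hM⟩ := zorn_le_nonempty₀ {J : Ideal D | J ≠ ⊤ ∧ IsTIdeal D J} (by
    intro c hc hchain y hy
    have hdir : DirectedOn (· ≤ ·) c := hchain.directedOn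
    refine ⟨sSup c, ⟨?_, ?_⟩, fun z hz => le_sSup hz⟩
    · rw [Ideal.ne_top_iff_one, Submodule.mem_sSup_of_directed ⟨y, hy⟩ hdir]
      rintro ⟨J, hJ, h1⟩
      exact (Ideal.ne_top_iff_one J).1 (hc hJ).1 h1
    · refine isTIdeal_of_le (ne_bot_of_le_ne_bot (hc hy).2.ne_bot (le_sSup hy)) ?_
      rintro d ⟨F, h1, h2, h3, h4⟩
      obtain ⟨J, hJ, hFJ⟩ := (CompleteLattice.isCompactElement_iff_le_of_directed_sSup_le _ F).1
        ((Submodule.fg_iff_compact F).1 h1) c ⟨y, hy⟩ hdir h3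
      exact le_sSup hJ ((hc hJ).2.mem_iff.1 ⟨F, h1, h2, hFJ, h4⟩)) I ⟨htop, hI⟩
  exact ⟨M, ⟨hM.prop.1, hM.prop.2, fun J hJ hJt hMJ => (hM.eq_of_le ⟨hJ, hJt⟩ hMJ).symm⟩, hIM⟩

lemma tMem_one_of_forall_not_le {I : Ideal D} (hI : I ≠ ⊥)
    (h : ∀ M, IsTMax D M → ¬ I ≤ M) : TMem D I 1 := by
  by_contra h1
  obtain ⟨M, hM, hIM⟩ := (isTIdeal_tIdeal I hI).exists_le_isTMax
    ((Ideal.ne_top_iff_one _).2 h1)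
  exact h M hM ((le_tIdeal I hI).trans hIM)

lemma TMem.of_forall_mul_mem {I J : Ideal D} {x : D} (hI : I ≠ ⊥) (hJ : TMem D J 1)
    (h : ∀ j ∈ J, j * x ∈ I) : TMem D I x := by
  obtain ⟨F, h1, h2, h3, h4⟩ := hJ
  by_cases hx : x = 0
  · exact hx ▸ tMem_of_mem hI (zero_mem I)
  refine ⟨Ideal.span {x} * F, Submodule.FG.mul (Submodule.fg_span_singleton x) h1, ?_, ?_, ?_⟩
  · exact mul_ne_zero (by simpa using hx) h2
  · intro z hz
    obtain ⟨f, hf, rfl⟩ := Ideal.mem_span_singleton_mul.1 hz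
    rw [mul_comm]
    exact h f (h3 hf)
  · intro a b hb hF
    have := h4 (a * x) b hb fun f hf => by
      rw [mul_assoc]
      exact hF _ (Ideal.mem_span_singleton_mul.2 ⟨f, hf, rfl⟩)
    rwa [mul_one] at this

lemma IsTMax.isPrime {M : Ideal D} (hM : IsTMax D M) : M.IsPrime := by
  refine ⟨hM.1, fun {a b} hab => or_iff_not_imp_left.2 fun ha => ?_⟩
  have hne : M ⊔ Ideal.span {a} ≠ ⊥ := ne_bot_of_le_ne_bot hM.2.1.ne_bot le_sup_left
  have h1 : TMem D (M ⊔ Ideal.span {a}) 1 := by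
    refine tMem_one_of_forall_not_le hne fun N hN hle => ha ?_
    rw [← hM.2.2 N hN.1 hN.2.1 (le_sup_left.trans hle)]
    exact hle (Ideal.mem_sup_right (Ideal.mem_span_singleton_self a))
  refine hM.2.1.mem_iff.1 (h1.of_forall_mul_mem hM.2.1.ne_bot fun j hj => ?_)
  obtain ⟨m, hm, z, hz, rfl⟩ := Submodule.mem_sup.1 hj
  obtain ⟨c, rfl⟩ := Ideal.mem_span_singleton'.1 hz
  rw [add_mul, mul_assoc]
  exact add_mem (M.mul_mem_right _ hm) (M.mul_mem_left _ hab)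

lemma isTIdeal_span_singleton {b : D} (hb : b ≠ 0) : IsTIdeal D (Ideal.span {b}) := by
  refine isTIdeal_of_le (by simpa using hb) ?_
  rintro d ⟨F, -, -, h3, h4⟩
  rw [Ideal.mem_span_singleton]
  simpa using h4 1 b hb fun f hf => by
    simpa using Ideal.mem_span_singleton.1 (h3 hf)

end Closure

/-! ### Localization at `t`-maximal ideals -/

section LocIdeal

variable {D : Type*} [CommRing D]

/-- The contraction to `D` of the extension of `I` to the localization at the complement
of the prime ideal `M`. -/
def locIdeal (I M : Ideal D) : Ideal D where
  carrier := {x | ∃ s ∈ Submonoid.closure ((M : Set D)ᶜ), s * x ∈ I}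
  add_mem' := by
    rintro x y ⟨s, hs, hx⟩ ⟨t, ht, hy⟩
    refine ⟨s * t, mul_mem hs ht, ?_⟩
    rw [show s * t * (x + y) = t * (s * x) + s * (t * y) by ring]
    exact add_mem (I.mul_mem_left _ hx) (I.mul_mem_left _ hy)
  zero_mem' := ⟨1, one_mem _, by simp⟩
  smul_mem' := by
    rintro c x ⟨s, hs, hx⟩
    refine ⟨s, hs, ?_⟩
    rw [smul_eq_mul, mul_left_comm]
    exact I.mul_mem_left _ hx

lemma mem_locIdeal {I M : Ideal D} [hM : M.IsPrime] {x : D} :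
    x ∈ locIdeal I M ↔ ∃ s, s ∉ M ∧ s * x ∈ I := by
  have : Submonoid.closure ((M : Set D)ᶜ) = M.primeCompl :=
    Submonoid.closure_eq M.primeCompl
  change (∃ s ∈ Submonoid.closure ((M : Set D)ᶜ), s * x ∈ I) ↔ _
  rw [this]
  rfl

lemma le_locIdeal (I M : Ideal D) : I ≤ locIdeal I M :=
  fun x hx => ⟨1, one_mem _, by simpa using hx⟩

lemma locIdeal_mono {I J : Ideal D} (h : I ≤ J) (M : Ideal D) : locIdeal I M ≤ locIdeal J M :=
  fun _ ⟨s, hs, hx⟩ => ⟨s, hs, h hx⟩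

lemma locIdeal_locIdeal_le (I M : Ideal D) : locIdeal (locIdeal I M) M ≤ locIdeal I M := by
  rintro x ⟨s, hs, t, ht, hx⟩
  exact ⟨t * s, mul_mem ht hs, by rwa [mul_assoc]⟩

lemma mul_locIdeal_le (I J M : Ideal D) :
    locIdeal I M * locIdeal J M ≤ locIdeal (I * J) M := by
  rw [Ideal.mul_le]
  rintro x ⟨s, hs, hx⟩ y ⟨t, ht, hy⟩
  refine ⟨s * t, mul_mem hs ht, ?_⟩
  rw [mul_mul_mul_comm]
  exact Ideal.mul_mem_mul hx hy

lemma mul_le_locIdeal {A B I J M : Ideal D} (hA : A ≤ locIdeal I M) (hB : B ≤ locIdeal J M) :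
    A * B ≤ locIdeal (I * J) M :=
  (Ideal.mul_mono hA hB).trans (mul_locIdeal_le I J M)

lemma locIdeal_le_of_le {I M : Ideal D} [hM : M.IsPrime] (h : I ≤ M) : locIdeal I M ≤ M := by
  intro x hx
  obtain ⟨s, hs, hx⟩ := mem_locIdeal.1 hx
  exact (hM.mem_or_mem (h hx)).resolve_left hs

end LocIdeal

section Local

variable {D : Type*} [CommRing D] [IsDomain D]

/-- An ideal of `D` whose extension to every localization at a `t`-maximal ideal is idempotent. -/
def LocIdem (I : Ideal D) : Prop :=
  ∀ M, IsTMax D M → I ≤ locIdeal (I * I) M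

variable (hD : IsPvMD D)
include hD

lemma IsPvMD.exists_mul_dvd {F M : Ideal D} (hF : F.FG) (hF0 : F ≠ ⊥) (hM : IsTMax D M) :
    ∃ f ∈ F, ∃ s, s ∉ M ∧ ∀ g ∈ F, f ∣ s * g := by
  have inj := IsFractionRing.injective D (FractionRing D)
  have hnot : ¬ coeI D F * (1 / coeI D F) ≤ coeI D M := by
    intro hle
    have h1 : (1 : FractionRing D) ∈ tSet D (coeI D F * (1 / coeI D F)) := by
      rw [hD F hF0 hF]
      exact Submodule.one_le.1 le_rfl
    have h2 : (1 : FractionRing D) ∈ tSet D (coeI D M) := by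
      simp only [tSet, Set.mem_iUnion] at h1 ⊢
      obtain ⟨G, ⟨g1, g2, g3⟩, hG⟩ := h1
      exact ⟨G, ⟨g1, g2, g3.trans hle⟩, hG⟩
    rw [← map_one (algebraMap D (FractionRing D)), algebraMap_mem_tSet, hM.2.1.mem_iff] at h2
    exact hM.1 ((Ideal.eq_top_iff_one M).2 h2)
  rw [Submodule.mul_le] at hnot
  push Not at hnot
  obtain ⟨m, hm, n, hn, hmn⟩ := hnot
  obtain ⟨f, hf, rfl⟩ := mem_coeI.1 hm
  rw [Submodule.mem_div_iff_forall_mul_mem] at hn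
  obtain ⟨s, hs⟩ := Submodule.mem_one.1 (hn _ hm)
  refine ⟨f, hf, s, ?_, ?_⟩
  · intro h
    apply hmn
    rw [mul_comm, ← hs]
    exact algebraMap_mem_coeI.2 h
  · intro g hg
    obtain ⟨u, hu⟩ := Submodule.mem_one.1 (hn _ (algebraMap_mem_coeI.2 hg))
    refine ⟨u, inj ?_⟩
    rw [map_mul, map_mul, hs, hu]
    ring

lemma IsPvMD.mem_locIdeal_of_tMem {I M : Ideal D} (hM : IsTMax D M) {x : D} (hx : TMem D I x) :
    x ∈ locIdeal I M := by
  have := hM.isPrime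
  obtain ⟨F, h1, h2, h3, h4⟩ := hx
  obtain ⟨f, hf, s, hs, hdvd⟩ := hD.exists_mul_dvd h1 h2 hM
  have hf0 : f ≠ 0 := by
    rintro rfl
    apply h2
    rw [eq_bot_iff]
    intro g hg
    have := zero_dvd_iff.1 (hdvd g hg)
    exact (mul_eq_zero.1 this).resolve_left fun h => hs (h ▸ zero_mem M)
  obtain ⟨c, hc⟩ := h4 s f hf0 hdvd
  exact mem_locIdeal.2 ⟨s, hs, hc ▸ I.mul_mem_right _ (h3 hf)⟩

lemma IsPvMD.exists_dvd_or_dvd {M : Ideal D} (hM : IsTMax D M) (a b : D) :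
    (∃ s, s ∉ M ∧ a ∣ s * b) ∨ ∃ s, s ∉ M ∧ b ∣ s * a := by
  have hMp := hM.isPrime
  by_cases hb : b = 0
  · subst hb
    exact Or.inl ⟨1, (Ideal.ne_top_iff_one M).1 hM.1, by simp⟩
  obtain ⟨f, hf, s, hs, hdvd⟩ := hD.exists_mul_dvd (F := Ideal.span {a, b})
    (Submodule.fg_span (by simp)) (fun h => hb (by
      have : b ∈ Ideal.span {a, b} := Ideal.subset_span (by simp)
      rwa [h] at this)) hM
  obtain ⟨u, v, rfl⟩ := Ideal.mem_span_pair.1 hf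
  obtain ⟨c, hc⟩ := hdvd a (Ideal.subset_span (by simp))
  obtain ⟨e, he⟩ := hdvd b (Ideal.subset_span (by simp))
  have hs0 : s ≠ 0 := fun h => hs (h ▸ zero_mem M)
  have hea : e * a = c * b := mul_left_cancel₀ hs0 (by
    rw [mul_left_comm, hc, mul_left_comm s c b, he]; ring)
  have hf0 : u * a + v * b ≠ 0 := by
    intro h
    rw [h, zero_mul] at he
    exact hb ((mul_eq_zero.1 he).resolve_left hs0)
  have hsum : s = u * c + v * e := mul_left_cancel₀ hf0 (by
    linear_combination u * hc + v * he)
  by_cases hcM : c ∈ M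
  · refine Or.inr ⟨e, fun heM => hs ?_, hea ▸ Dvd.intro_left c rfl⟩
    rw [hsum]
    exact add_mem (M.mul_mem_left _ hcM) (M.mul_mem_left _ heM)
  · exact Or.inl ⟨c, hcM, hea ▸ Dvd.intro_left e rfl⟩

lemma IsPvMD.tMem_iff {I : Ideal D} (hI : I ≠ ⊥) {x : D} :
    TMem D I x ↔ ∀ M, IsTMax D M → x ∈ locIdeal I M := by
  refine ⟨fun hx M hM => hD.mem_locIdeal_of_tMem hM hx, fun h => ?_⟩
  let J : Ideal D := Submodule.comap (LinearMap.mulRight D x) I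
  have hIJ : I ≤ J := fun i hi => I.mul_mem_right x hi
  refine (tMem_one_of_forall_not_le (ne_bot_of_le_ne_bot hI hIJ) ?_).of_forall_mul_mem hI
    (J := J) fun j hj => hj
  intro M hM hJM
  have := hM.isPrime
  obtain ⟨s, hs, hx⟩ := mem_locIdeal.1 (h M hM)
  exact hs (hJM hx)

lemma IsPvMD.tIdem_iff_locIdem {I : Ideal D} (hI : IsTIdeal D I) : TIdem D I ↔ LocIdem I := by
  have hII : I * I ≠ ⊥ := mul_ne_zero hI.ne_bot hI.ne_bot
  rw [tIdem_iff]
  constructor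
  · intro h M hM x hx
    exact hD.mem_locIdeal_of_tMem hM ((h x).2 (hI.mem_iff.2 hx))
  · intro h d
    refine ⟨TMem.mono Ideal.mul_le_left, fun hd => ?_⟩
    exact (hD.tMem_iff hII).2 fun M hM => h M hM (hI.mem_iff.1 hd)

lemma IsPvMD.le_locIdeal_span_mul {P M : Ideal D} (hP : P.IsPrime) (hM : IsTMax D M)
    (hPM : P ≤ M) {b : D} (hb : b ∉ P) : P ≤ locIdeal (Ideal.span {b} * P) M := by
  have := hM.isPrime
  intro a ha
  rcases hD.exists_dvd_or_dvd hM b a with ⟨s, hs, r, hr⟩ | ⟨s, hs, r, hr⟩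
  · refine mem_locIdeal.2 ⟨s, hs, Ideal.mem_span_singleton_mul.2 ⟨r, ?_, hr.symm⟩⟩
    refine (hP.mem_or_mem ?_).resolve_left hb
    rw [← hr]
    exact P.mul_mem_left _ ha
  · refine absurd ((hP.mem_or_mem ?_).resolve_right hb) fun h => hs (hPM h)
    rw [hr]
    exact P.mul_mem_right _ ha

/-- A prime `t`-ideal that is not `t`-maximal is divisorial. -/
lemma IsPvMD.vIdeal_le_of_not_isTMax (hfc : FiniteTCharacter D) {P : Ideal D} (hP : P.IsPrime)
    (hPt : IsTIdeal D P) (hPM : ¬ IsTMax D P) : vIdeal D P ≤ P := by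
  intro y hy
  by_contra hyP
  obtain ⟨M₁, hM₁, hPM₁⟩ := hPt.exists_le_isTMax hP.ne_top
  have hM₁p := hM₁.isPrime
  obtain ⟨b, hbM, hbP⟩ : ∃ b ∈ M₁, b ∉ P :=
    Set.not_subset.1 fun h => hPM (le_antisymm hPM₁ h ▸ hM₁)
  obtain ⟨a, haP, ha0⟩ := Submodule.exists_mem_ne_zero_of_ne_bot hPt.ne_bot
  obtain ⟨F, hFG, hFP, hFM⟩ : ∃ F : Ideal D, F.FG ∧ F ≤ P ∧
      ∀ M, IsTMax D M → ¬ P ≤ M → ¬ F ≤ M := by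
    have hex : ∀ M : Ideal D, ∃ f ∈ P, ¬ P ≤ M → f ∉ M := by
      intro M
      by_cases hle : P ≤ M
      · exact ⟨0, zero_mem P, fun h => absurd hle h⟩
      · obtain ⟨f, hf, hfM⟩ := Set.not_subset.1 hle
        exact ⟨f, hf, fun _ => hfM⟩
    choose f hfP hfM using hex
    refine ⟨Ideal.span (insert a (f '' {M | IsTMax D M ∧ a ∈ M})),
      Submodule.fg_span (((hfc a ha0).image f).insert a), ?_, ?_⟩
    · rw [Ideal.span_le]
      rintro x (rfl | ⟨M, -, rfl⟩)
      exacts [haP, hfP M]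
    · intro M hM hPM hle
      have haM : a ∈ M := hle (Ideal.subset_span (by simp))
      exact hfM M hPM (hle (Ideal.subset_span (Or.inr ⟨M, ⟨hM, haM⟩, rfl⟩)))
  have hybP : y * b ∉ P := fun h => (hP.mem_or_mem h).elim hyP hbP
  have hyG : y ∈ vIdeal D (F ⊔ Ideal.span {y * b}) := by
    intro α β hβ hG
    refine hy α β hβ fun p hp => ?_
    rw [← Ideal.mem_span_singleton, ← (isTIdeal_span_singleton hβ).mem_iff,
      hD.tMem_iff (by simpa using hβ)]
    intro M hM
    have := hM.isPrime
    rw [mem_locIdeal]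
    by_cases hle : P ≤ M
    · obtain ⟨s, hs, hsp⟩ :=
        mem_locIdeal.1 (hD.le_locIdeal_span_mul hP hM hle hybP hp)
      obtain ⟨r, -, hr⟩ := Ideal.mem_span_singleton_mul.1 hsp
      refine ⟨s, hs, Ideal.mem_span_singleton.2 ?_⟩
      have h1 : β ∣ α * (y * b) :=
        hG _ (Ideal.mem_sup_right (Ideal.mem_span_singleton_self _))
      rw [mul_left_comm, ← hr, ← mul_assoc]
      exact h1.mul_right r
    · obtain ⟨f, hf, hfM⟩ := Set.not_subset.1 (hFM M hM hle)
      refine ⟨f, hfM, Ideal.mem_span_singleton.2 ?_⟩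
      rw [show f * (α * p) = α * f * p by ring]
      exact (hG f (Ideal.mem_sup_left hf)).mul_right p
  have hT : TMem D (F ⊔ Ideal.span {y * b}) y := by
    refine ⟨_, Submodule.FG.sup hFG (Submodule.fg_span_singleton _), fun h => hybP ?_, le_rfl, hyG⟩
    have : y * b ∈ F ⊔ Ideal.span {y * b} :=
      Ideal.mem_sup_right (Ideal.mem_span_singleton_self _)
    rw [h] at this
    rw [(Submodule.mem_bot D).1 this]
    exact zero_mem P
  obtain ⟨s, hs, hsy⟩ := mem_locIdeal.1 (hD.mem_locIdeal_of_tMem hM₁ hT)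
  obtain ⟨f, hf, z, hz, hsum⟩ := Submodule.mem_sup.1 hsy
  obtain ⟨r, rfl⟩ := Ideal.mem_span_singleton'.1 hz
  have h1 : y * (s - b * r) ∈ P := by
    rw [show y * (s - b * r) = f by linear_combination -hsum]
    exact hFP hf
  have h2 := hPM₁ ((hP.mem_or_mem h1).resolve_left hyP)
  apply hs
  rw [show s = (s - b * r) + b * r by ring]
  exact add_mem h2 (M₁.mul_mem_right _ hbM)

/-- A locally idempotent `t`-maximal ideal has trivial divisorial closure. -/
lemma IsPvMD.one_mem_vIdeal {M : Ideal D} (hM : IsTMax D M) (hidem : LocIdem M) :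
    1 ∈ vIdeal D M := by
  have hMp := hM.isPrime
  intro a b hb hab
  rw [mul_one]
  by_contra hnd
  let C : Ideal D := Submodule.comap (LinearMap.mulLeft D a) (Ideal.span {b})
  have hC : ∀ d, d ∈ C ↔ b ∣ a * d := fun d => Ideal.mem_span_singleton
  have hMC : M ≤ C := fun m hm => (hC m).2 (hab m hm)
  have hCM : C = M := by
    refine hM.2.2 C ?_ ?_ hMC
    · rw [Ideal.ne_top_iff_one, hC, mul_one]
      exact hnd
    · refine isTIdeal_of_le (ne_bot_of_le_ne_bot hM.2.1.ne_bot hMC) ?_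
      rintro d ⟨F, -, -, h3, h4⟩
      exact (hC d).2 (h4 a b hb fun f hf => (hC f).1 (h3 hf))
  rcases hD.exists_dvd_or_dvd hM a b with ⟨c, hc, e, he⟩ | ⟨e, he, hdvd⟩
  · have heM : e ∈ M := by
      rw [← hCM, hC, ← he]
      exact Dvd.intro_left c rfl
    have he0 : e ≠ 0 := by
      rintro rfl
      rw [mul_zero] at he
      exact (mul_eq_zero.1 he).elim (fun h => hc (h ▸ zero_mem M)) hb
    have hMe : M ≤ locIdeal (Ideal.span {e}) M := by
      intro d hd
      refine mem_locIdeal.2 ⟨c, hc, Ideal.mem_span_singleton.2 ?_⟩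
      obtain ⟨g, hg⟩ := hab d hd
      exact ⟨g, mul_left_cancel₀ hb (by linear_combination d * he + e * hg)⟩
    have h1 := locIdeal_locIdeal_le _ _
      (locIdeal_mono (mul_le_locIdeal hMe hMe) M (hidem M hM heM))
    obtain ⟨s, hs, hse⟩ := mem_locIdeal.1 h1
    rw [Ideal.span_singleton_mul_span_singleton, Ideal.mem_span_singleton] at hse
    obtain ⟨g, hg⟩ := hse
    apply hs
    rw [show s = e * g from mul_right_cancel₀ he0 (by linear_combination hg)]
    exact M.mul_mem_right _ heM
  · refine he ?_
    rw [← hCM, hC, mul_comm]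
    exact hdvd

lemma IsPvMD.exists_le_locIdeal_prod {N : Ideal D} (hN : IsTMax D N) (s : Multiset (Ideal D))
    (hs : ∀ P ∈ s, P.IsPrime ∧ LocIdem P) (hs0 : s ≠ 0) :
    ∃ P ∈ s, P ≤ locIdeal s.prod N := by
  have := hN.isPrime
  induction s using Multiset.induction_on with
  | empty => exact absurd rfl hs0
  | cons P s ih =>
    rcases eq_or_ne s 0 with rfl | hs0
    · exact ⟨P, by simp, by simpa using le_locIdeal P N⟩
    obtain ⟨Q, hQs, hQ⟩ := ih (fun P hP => hs P (Multiset.mem_cons_of_mem hP)) hs0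
    have hPp := hs P (Multiset.mem_cons_self P s)
    have hQp := hs Q (Multiset.mem_cons_of_mem hQs)
    rw [Multiset.prod_cons]
    have hmul : P * Q ≤ locIdeal (P * s.prod) N := mul_le_locIdeal (le_locIdeal P N) hQ
    have hloc : ∀ {A : Ideal D}, A ≤ locIdeal (P * Q) N → A ≤ locIdeal (P * s.prod) N :=
      fun h => h.trans ((locIdeal_mono hmul N).trans (locIdeal_locIdeal_le _ _))
    by_cases hPN : P ≤ N
    · by_cases hQP : Q ≤ P
      · refine ⟨Q, Multiset.mem_cons_of_mem hQs, hloc ?_⟩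
        by_cases hPQ : P ≤ Q
        · obtain rfl := le_antisymm hQP hPQ
          exact hQp.2 N hN
        · obtain ⟨b, hb, hbQ⟩ := Set.not_subset.1 hPQ
          refine (hD.le_locIdeal_span_mul hQp.1 hN (hQP.trans hPN) hbQ).trans
            (locIdeal_mono (Ideal.mul_mono_left ?_) N)
          rwa [Ideal.span_singleton_le_iff_mem]
      · obtain ⟨b, hb, hbP⟩ := Set.not_subset.1 hQP
        refine ⟨P, Multiset.mem_cons_self P s, hloc ?_⟩
        refine (hD.le_locIdeal_span_mul hPp.1 hN hPN hbP).trans (locIdeal_mono ?_ N)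
        rw [mul_comm]
        refine Ideal.mul_mono_right ?_
        rwa [Ideal.span_singleton_le_iff_mem]
    · obtain ⟨p, hp, hpN⟩ := Set.not_subset.1 hPN
      refine ⟨Q, Multiset.mem_cons_of_mem hQs, hloc fun q hq => ?_⟩
      exact mem_locIdeal.2 ⟨p, hpN, Ideal.mul_mem_mul hp hq⟩

lemma IsPvMD.mem_locIdeal_prod {N : Ideal D} (hN : IsTMax D N) (s : Multiset (Ideal D))
    (hs : ∀ P ∈ s, P.IsPrime ∧ LocIdem P) {x : D} (hx : ∀ P ∈ s, x ∈ P) :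
    x ∈ locIdeal s.prod N := by
  rcases eq_or_ne s 0 with rfl | hs0
  · exact le_locIdeal _ _ (by simp)
  · obtain ⟨P, hP, hle⟩ := hD.exists_le_locIdeal_prod hN s hs hs0
    exact hle (hx P hP)

lemma IsPvMD.tIdem_and_isDivisorial_of_prod {I : Ideal D} (hI : IsTIdeal D I)
    (s : Multiset (Ideal D))
    (hs : ∀ P ∈ s, P.IsPrime ∧ IsTIdeal D P ∧ TIdem D P ∧ IsDivisorial D P)
    (hprod : tSet D (coeI D s.prod) = (coeI D I : Set (FractionRing D))) :
    TIdem D I ∧ IsDivisorial D I := by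
  rw [tSet_eq_coeI_iff] at hprod
  have hsP : ∀ P ∈ s, P.IsPrime ∧ LocIdem P := fun P hP =>
    ⟨(hs P hP).1, (hD.tIdem_iff_locIdem (hs P hP).2.1).1 (hs P hP).2.2.1⟩
  have hprod0 : s.prod ≠ ⊥ := ((hprod 0).2 (zero_mem I)).ne_bot
  have hIP : ∀ P ∈ s, I ≤ P := fun P hP x hx =>
    (hs P hP).2.1.mem_iff.1 (((hprod x).2 hx).mono (Ideal.le_of_dvd (Multiset.dvd_prod hP)))
  have hsI : s.prod ≤ I := fun x hx => (hprod x).1 (tMem_of_mem hprod0 hx)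
  constructor
  · rw [hD.tIdem_iff_locIdem hI]
    intro N hN x hx
    have := hD.mem_locIdeal_prod hN (s + s)
      (fun P hP => hsP P ((Multiset.mem_add.1 hP).elim id id)) (x := x)
      fun P hP => hIP P ((Multiset.mem_add.1 hP).elim id id) hx
    rw [Multiset.prod_add] at this
    exact locIdeal_mono (Ideal.mul_mono hsI hsI) N this
  · rw [isDivisorial_iff]
    intro x hx
    refine (hprod x).1 ((hD.tMem_iff hprod0).2 fun N hN => hD.mem_locIdeal_prod hN s hsP ?_)
    intro P hP
    exact isDivisorial_iff.1 (hs P hP).2.2.2 (vIdeal_mono (hIP P hP) hx)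

lemma IsPvMD.isPrime_locIdeal {I M : Ideal D} (hI : LocIdem I)
    (hM : IsTMax D M) (hIM : I ≤ M) : (locIdeal I M).IsPrime := by
  have hMp := hM.isPrime
  have hle := locIdeal_le_of_le hIM
  refine ⟨ne_top_of_le_ne_top hM.1 hle, fun {x y} hxy => ?_⟩
  by_contra! hxy'
  have hdvd : ∀ z, z ∉ locIdeal I M → I ≤ locIdeal (Ideal.span {z}) M := by
    intro z hz i hi
    rcases hD.exists_dvd_or_dvd hM z i with ⟨t, ht, h⟩ | ⟨t, ht, r, hr⟩
    · exact mem_locIdeal.2 ⟨t, ht, Ideal.mem_span_singleton.2 h⟩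
    · exact absurd (mem_locIdeal.2 ⟨t, ht, hr ▸ I.mul_mem_right _ hi⟩) hz
  have h1 : I ≤ locIdeal (Ideal.span {x * y}) M := by
    have := mul_le_locIdeal (hdvd x hxy'.1) (hdvd y hxy'.2)
    rw [Ideal.span_singleton_mul_span_singleton] at this
    exact (hI M hM).trans ((locIdeal_mono this M).trans (locIdeal_locIdeal_le _ _))
  have h2 : I ≤ locIdeal (Ideal.span {x * y} * Ideal.span {x * y}) M :=
    (hI M hM).trans ((locIdeal_mono (mul_le_locIdeal h1 h1) M).trans (locIdeal_locIdeal_le _ _))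
  have h3 := locIdeal_locIdeal_le _ _ (locIdeal_mono h2 M hxy)
  rw [Ideal.span_singleton_mul_span_singleton] at h3
  obtain ⟨s, hs, hs'⟩ := mem_locIdeal.1 h3
  obtain ⟨r, hr⟩ := Ideal.mem_span_singleton.1 hs'
  have h0 : x * y ≠ 0 := by
    intro h0
    rcases mul_eq_zero.1 h0 with h | h
    · exact hxy'.1 (h ▸ zero_mem _)
    · exact hxy'.2 (h ▸ zero_mem _)
  apply hs
  rw [show s = x * y * r from mul_right_cancel₀ h0 (by linear_combination hr)]
  exact M.mul_mem_right _ (hle hxy)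

lemma IsPvMD.isTIdeal_locIdeal {I M : Ideal D} (hI0 : I ≠ ⊥) (hM : IsTMax D M) :
    IsTIdeal D (locIdeal I M) :=
  isTIdeal_of_le (ne_bot_of_le_ne_bot hI0 (le_locIdeal I M)) fun _ hd =>
    locIdeal_locIdeal_le _ _ (hD.mem_locIdeal_of_tMem hM hd)

lemma IsPvMD.locIdem_locIdeal {I M : Ideal D} (hI : LocIdem I)
    (hM : IsTMax D M) (hIM : I ≤ M) : LocIdem (locIdeal I M) := by
  intro N hN x hx
  have hMp := hM.isPrime
  have hNp := hN.isPrime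
  have hQ := hD.isPrime_locIdeal hI hM hIM
  set Q := locIdeal I M with hQdef
  by_cases hQN : Q ≤ N
  · have hx2 : x ∈ locIdeal (Q * Q) M :=
      locIdeal_mono (Ideal.mul_mono (le_locIdeal I M) (le_locIdeal I M)) M
        (locIdeal_locIdeal_le _ _ (locIdeal_mono (hI M hM) M hx))
    obtain ⟨s, hs, hsx⟩ := mem_locIdeal.1 hx2
    have hsQ : s ∉ Q := fun h => hs (locIdeal_le_of_le hIM h)
    have hle : Q * Q ≤ locIdeal (Ideal.span {s} * (Q * Q)) N := by
      rw [← mul_assoc]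
      exact mul_le_locIdeal (hD.le_locIdeal_span_mul hQ hN hQN hsQ) (le_locIdeal Q N)
    obtain ⟨t, ht, htx⟩ := mem_locIdeal.1 (hle hsx)
    obtain ⟨z, hz, hzx⟩ := Ideal.mem_span_singleton_mul.1 htx
    have hs0 : s ≠ 0 := fun h => hs (h ▸ zero_mem M)
    refine mem_locIdeal.2 ⟨t, ht, ?_⟩
    rwa [show t * x = z from mul_left_cancel₀ hs0 (by linear_combination -hzx)]
  · obtain ⟨q, hq, hqN⟩ := Set.not_subset.1 hQN
    exact mem_locIdeal.2 ⟨q, hqN, Ideal.mul_mem_mul hq hx⟩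

lemma IsPvMD.exists_prod_of_tIdem (hfc : FiniteTCharacter D) {I : Ideal D}
    (hI : IsTIdeal D I) (hidem : TIdem D I) (hdiv : IsDivisorial D I) :
    ∃ s : Multiset (Ideal D),
      (∀ P ∈ s, P.IsPrime ∧ IsTIdeal D P ∧ TIdem D P ∧ ¬ IsTMax D P) ∧
      tSet D (coeI D s.prod) = (coeI D I : Set (FractionRing D)) := by
  classical
  have hI0 := hI.ne_bot
  rw [hD.tIdem_iff_locIdem hI] at hidem
  rw [isDivisorial_iff] at hdiv
  obtain ⟨a, haI, ha0⟩ := Submodule.exists_mem_ne_zero_of_ne_bot hI0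
  have hfin : {M | IsTMax D M ∧ I ≤ M}.Finite :=
    (hfc a ha0).subset fun M hM => ⟨hM.1, hM.2 haI⟩
  set S := hfin.toFinset with hS
  have hmem : ∀ M, M ∈ S ↔ IsTMax D M ∧ I ≤ M := fun M => by simp [hS]
  have hprime : ∀ M ∈ S, (locIdeal I M).IsPrime := fun M hM =>
    hD.isPrime_locIdeal hidem ((hmem M).1 hM).1 ((hmem M).1 hM).2
  have hlocidem : ∀ M ∈ S, LocIdem (locIdeal I M) := fun M hM =>
    hD.locIdem_locIdeal hidem ((hmem M).1 hM).1 ((hmem M).1 hM).2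
  have hprodI : (S.val.map (locIdeal I)).prod ≤ I := by
    intro x hx
    rw [← hI.mem_iff, hD.tMem_iff hI0]
    intro M hM
    by_cases hIM : I ≤ M
    · refine Ideal.le_of_dvd (Multiset.dvd_prod ?_) hx
      exact Multiset.mem_map_of_mem _ ((hmem M).2 ⟨hM, hIM⟩)
    · have := hM.isPrime
      obtain ⟨i, hi, hiM⟩ := Set.not_subset.1 hIM
      exact mem_locIdeal.2 ⟨i, hiM, I.mul_mem_right _ hi⟩
  refine ⟨S.val.map (locIdeal I), ?_, ?_⟩
  · intro P hP
    obtain ⟨M, hMS, rfl⟩ := Multiset.mem_map.1 hP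
    obtain ⟨hM, hIM⟩ := (hmem M).1 hMS
    have hMp := hM.isPrime
    have hQt := hD.isTIdeal_locIdeal hI0 hM
    refine ⟨hprime M hMS, hQt, (hD.tIdem_iff_locIdem hQt).2 (hlocidem M hMS), fun hmax => ?_⟩
    have hMQ : M = locIdeal I M := hmax.2.2 M hM.1 hM.2.1 (locIdeal_le_of_le hIM)
    have h1 : 1 ∈ vIdeal D M := hD.one_mem_vIdeal hM (hMQ ▸ hlocidem M hMS)
    have hsplit : M * ((S.erase M).val.map (locIdeal I)).prod ≤ I := by
      refine le_trans (le_of_eq ?_) hprodI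
      nth_rewrite 1 [hMQ]
      exact Finset.mul_prod_erase S (locIdeal I) hMS
    have hJM : ((S.erase M).val.map (locIdeal I)).prod ≤ M := by
      refine le_trans (fun j hj => hdiv ?_) hIM
      intro α β hβ hα
      have := h1 (α * j) β hβ fun m hm => by
        rw [mul_assoc, mul_comm j m]
        exact hα _ (hsplit (Ideal.mul_mem_mul hm hj))
      rwa [mul_one] at this
    obtain ⟨Q, hQ, hQM⟩ := (hMp.multiset_prod_le).1 hJM
    obtain ⟨N, hNS, rfl⟩ := Multiset.mem_map.1 hQ
    obtain ⟨hNM, hNS⟩ := Finset.mem_erase.1 hNS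
    obtain ⟨hN, hIN⟩ := (hmem N).1 hNS
    have hNp := hN.isPrime
    apply hNM
    refine hM.2.2 N hN.1 hN.2.1 fun x hx => ?_
    rw [hMQ] at hx
    obtain ⟨s, hs, hsx⟩ := mem_locIdeal.1 hx
    exact locIdeal_le_of_le hIN
      (((hprime N hNS).mem_or_mem (le_locIdeal I N hsx)).resolve_left fun h => hs (hQM h))
  · rw [tSet_eq_coeI_iff]
    have hprod0 : (S.val.map (locIdeal I)).prod ≠ ⊥ := by
      refine Multiset.prod_ne_zero fun h => ?_
      obtain ⟨M, -, hM⟩ := Multiset.mem_map.1 h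
      exact ne_bot_of_le_ne_bot hI0 (le_locIdeal I M) hM
    intro d
    refine ⟨fun hd => hI.mem_iff.1 (hd.mono hprodI), fun hd => ?_⟩
    refine (hD.tMem_iff hprod0).2 fun N hN => hD.mem_locIdeal_prod hN _ ?_ ?_
    · intro P hP
      obtain ⟨M, hMS, rfl⟩ := Multiset.mem_map.1 hP
      exact ⟨hprime M hMS, hlocidem M hMS⟩
    · intro P hP
      obtain ⟨M, -, rfl⟩ := Multiset.mem_map.1 hP
      exact le_locIdeal I M hd

lemma IsPvMD.isDivisorial_iff_not_isTMax (hfc : FiniteTCharacter D) {P : Ideal D}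
    (hP : P.IsPrime) (hPt : IsTIdeal D P) (hidem : TIdem D P) :
    IsDivisorial D P ↔ ¬ IsTMax D P := by
  rw [isDivisorial_iff]
  constructor
  · intro h hmax
    exact hP.one_notMem (h (hD.one_mem_vIdeal hmax ((hD.tIdem_iff_locIdem hPt).1 hidem)))
  · exact hD.vIdeal_le_of_not_isTMax hfc hP hPt

end Local

theorem statement18 (D : Type*) [CommRing D] [IsDomain D]
    (hPvMD : IsPvMD D) (hfc : FiniteTCharacter D)
    (I : Ideal D) (hI0 : I ≠ ⊥) (hItop : I ≠ ⊤) (hIt : IsTIdeal D I) :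
    ((TIdem D I ∧ IsDivisorial D I) ↔
      ∃ s : Multiset (Ideal D),
        (∀ P ∈ s, P.IsPrime ∧ IsTIdeal D P ∧ TIdem D P ∧ ¬ IsTMax D P) ∧
        tSet D (coeI D s.prod) = (coeI D I : Set (FractionRing D))) ∧
    ((TIdem D I ∧ IsDivisorial D I) ↔
      ∃ s : Multiset (Ideal D),
        (∀ P ∈ s, P.IsPrime ∧ IsTIdeal D P ∧ TIdem D P ∧ IsDivisorial D P) ∧
        tSet D (coeI D s.prod) = (coeI D I : Set (FractionRing D))) := by
  have key : ∀ s : Multiset (Ideal D),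
      (∀ P ∈ s, P.IsPrime ∧ IsTIdeal D P ∧ TIdem D P ∧ ¬ IsTMax D P) ↔
        ∀ P ∈ s, P.IsPrime ∧ IsTIdeal D P ∧ TIdem D P ∧ IsDivisorial D P := by
    refine fun s => forall₂_congr fun P _ => and_congr_right fun h1 => and_congr_right fun h2 =>
      and_congr_right fun h3 => ?_
    exact (hPvMD.isDivisorial_iff_not_isTMax hfc h1 h2 h3).symm
  simp only [key, and_self]
  constructor
  · rintro ⟨h1, h2⟩
    simpa only [key] using hPvMD.exists_prod_of_tIdem hfc hIt h1 h2
  · rintro ⟨s, hs, hprod⟩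
    exact hPvMD.tIdem_and_isDivisorial_of_prod hIt s hs hprod

end
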